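/- There is an absolute constant C > 0 such that the following holds. Fix δ ∈ (0,1), B ≥ 1, d ≥ 2, ℓ ≥ 1, k ≤ d, and a 1-Lipschitz function σ : ℝ → ℝ with σ(0)=0. For a weight vector w ∈ ℝ^m enumerating the entries of matrices W_1 ∈ ℝ^{d_1×k}, …, W_ℓ ∈ ℝ^{d_ℓ×d_{ℓ−1}} with all d_i ≤ d, let g_w(x) = σ(W_ℓ·σ(⋯σ(W_1·x))) (σ applied entrywise), and let D(g_w) be the pushforward of N(0,I_k) under g_w. Let ε ≥ 0 and let 𝒟 be any family of pairs (D_0,D_1) of Borel probability measures on ℝ^{d_ℓ} such that for each (D_0,D_1) ∈ 𝒟 and each i ∈ {0,1} there exists w ∈ [−B,B]^m with W∞(D_i, D(g_w)) ≤ ε. Then there exists a finite set 𝒩 of pairs of Borel probability measures on ℝ^{d_ℓ} with log|𝒩| ≤ C·m·ℓ·log(dB/δ) such that for every (D_0,D_1) ∈ 𝒟 there is a pair (E_0,E_1) ∈ 𝒩 with the property that for each i ∈ {0,1} there exists a Borel probability measure E''_i with TV(E_i, E''_i) ≤ δ and W∞(E''_i, D_i) ≤ ε + δ. -/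

import Mathlib

open MeasureTheory

noncomputable section

/-- A feedforward neural network with activation `σ` applied entrywise after each layer. -/
def net (σ : ℝ → ℝ) (dims : ℕ → ℕ)
    (W : (i : ℕ) → Matrix (Fin (dims (i + 1))) (Fin (dims i)) ℝ) :
    (n : ℕ) → (Fin (dims 0) → ℝ) → (Fin (dims n) → ℝ)
  | 0 => fun x => x
  | n + 1 => fun x j => σ (((W n).mulVec (net σ dims W n x)) j)

/-- The generated distribution `D(g_w)`: the pushforward of the standard Gaussian `N(0, I_{dims 0})`
under the network, viewed as a measure on Euclidean space `ℝ^{dims n}`. -/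
def netDist (σ : ℝ → ℝ) (dims : ℕ → ℕ)
    (W : (i : ℕ) → Matrix (Fin (dims (i + 1))) (Fin (dims i)) ℝ) (n : ℕ) :
    Measure (EuclideanSpace ℝ (Fin (dims n))) :=
  Measure.map (fun x : Fin (dims 0) → ℝ =>
      (EuclideanSpace.equiv (Fin (dims n)) ℝ).symm (net σ dims W n x))
    (Measure.pi fun _ : Fin (dims 0) => ProbabilityTheory.gaussianReal 0 1)

/-- Total variation distance: `sup` over measurable sets of `|μ s − ν s|`. -/
def tvDist {α : Type*} [MeasurableSpace α] (μ ν : Measure α) : ℝ :=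
  ⨆ s : {s : Set α // MeasurableSet s}, |(μ s).toReal - (ν s).toReal|

/-- `W∞` distance: infimum over couplings `π` of `μ` and `ν` of the `π`-essential
supremum of `‖x − y‖`. -/
def Winfty {E : Type*} [NormedAddCommGroup E] [MeasurableSpace E] (μ ν : Measure E) : ENNReal :=
  ⨅ (π : Measure (E × E)) (_ : π.fst = μ ∧ π.snd = ν),
    essSup (fun p : E × E => ENNReal.ofReal ‖p.1 - p.2‖) π

open ProbabilityTheory in
lemma glue_aux {X E : Type*} [MeasurableSpace X] [NormedAddCommGroup E] [MeasurableSpace E]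
    [BorelSpace E] [SecondCountableTopology E] [CompleteSpace E]
    (γ : Measure X) [IsProbabilityMeasure γ] (g h : X → E) (hg : Measurable g) (hh : Measurable h)
    (D : Measure E) [IsProbabilityMeasure D] (ε δ : ℝ) (hε : 0 ≤ ε) (hδ : 0 < δ)
    (hW : Winfty D (γ.map g) ≤ ENNReal.ofReal ε)
    (hd : ∀ x, ‖h x - g x‖ ≤ δ / 2) :
    Winfty (γ.map h) D ≤ ENNReal.ofReal (ε + δ) := by
  have hlt : Winfty D (γ.map g) < ENNReal.ofReal (ε + δ / 2) := by
    refine lt_of_le_of_lt hW ?_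
    rw [ENNReal.ofReal_lt_ofReal_iff (by linarith)]
    linarith
  unfold Winfty at hlt
  simp only [iInf_lt_iff] at hlt
  obtain ⟨π, ⟨h1, h2⟩, hess⟩ := hlt
  have hpi : IsProbabilityMeasure π := by
    constructor
    rw [← Measure.fst_univ, h1]
    exact measure_univ
  set π' : Measure (E × E) := π.map Prod.swap with hπ'
  have : IsProbabilityMeasure π' := Measure.isProbabilityMeasure_map measurable_swap.aemeasurable
  have hf : π'.fst = γ.map g := by rw [hπ', Measure.fst_map_swap, h2]
  have hs : π'.snd = D := by rw [hπ', Measure.snd_map_swap, h1]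
  set κ := π'.condKernel
  set J : Measure (X × E) := γ ⊗ₘ (κ.comap g hg) with hJ
  have hmg : Measurable (Prod.map g (id : E → E)) := hg.prodMap measurable_id
  have hmh : Measurable (Prod.map h (id : E → E)) := hh.prodMap measurable_id
  have hJmap : J.map (Prod.map g id) = π' := by
    rw [← π'.disintegrate π'.condKernel, hf]
    ext s hs
    have := Measure.isProbabilityMeasure_map (μ := γ) hg.aemeasurable
    rw [Measure.map_apply hmg hs, hJ, Measure.compProd_apply (hmg hs), Measure.compProd_apply hs,
      lintegral_map (Kernel.measurable_kernel_prodMk_left hs) hg]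
    rfl
  have hae : ∀ᵐ p ∂π, ENNReal.ofReal ‖p.1 - p.2‖ ≤ ENNReal.ofReal (ε + δ / 2) := by
    filter_upwards [ae_lt_of_essSup_lt hess] with p hp using hp.le
  have hset : ∀ c : ENNReal, MeasurableSet {p : E × E | ENNReal.ofReal ‖p.1 - p.2‖ ≤ c} := by
    intro c
    refine measurableSet_le ?_ measurable_const
    fun_prop
  have hset' : ∀ c : ENNReal, MeasurableSet {p : E × E | ENNReal.ofReal ‖p.2 - p.1‖ ≤ c} := by
    intro c
    refine measurableSet_le ?_ measurable_const
    fun_prop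
  have hae' : ∀ᵐ p ∂π', ENNReal.ofReal ‖p.2 - p.1‖ ≤ ENNReal.ofReal (ε + δ / 2) := by
    rw [hπ', ae_map_iff measurable_swap.aemeasurable (hset' _)]
    simpa using hae
  rw [← hJmap, ae_map_iff hmg.aemeasurable (hset' _)] at hae'
  unfold Winfty
  refine iInf₂_le_of_le (J.map (Prod.map h id)) ⟨?_, ?_⟩ ?_
  · rw [Measure.fst, Measure.map_map measurable_fst hmh]
    have : (Prod.fst ∘ Prod.map h (id : E → E)) = h ∘ Prod.fst := rfl
    rw [this, ← Measure.map_map hh measurable_fst]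
    congr 1
    exact Measure.fst_compProd _ _
  · rw [Measure.snd, Measure.map_map measurable_snd hmh, ← hs, ← hJmap, Measure.snd,
      Measure.map_map measurable_snd hmg]
    rfl
  · refine essSup_le_of_ae_le _ ?_
    change ∀ᵐ p ∂(J.map (Prod.map h id)), ENNReal.ofReal ‖p.1 - p.2‖ ≤ ENNReal.ofReal (ε + δ)
    rw [ae_map_iff hmh.aemeasurable (hset _)]
    filter_upwards [hae'] with p hp
    have hp' : ‖p.2 - g p.1‖ ≤ ε + δ / 2 := by
      rw [ENNReal.ofReal_le_ofReal_iff (by linarith)] at hp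
      exact hp
    apply ENNReal.ofReal_le_ofReal
    change ‖h p.1 - p.2‖ ≤ _
    calc ‖h p.1 - p.2‖ = ‖(h p.1 - g p.1) - (p.2 - g p.1)‖ := by congr 1; abel
      _ ≤ ‖h p.1 - g p.1‖ + ‖p.2 - g p.1‖ := norm_sub_le _ _
      _ ≤ _ := by linarith [hd p.1]

lemma tv_aux {X E : Type*} [MeasurableSpace X] [MeasurableSpace E]
    (γ : Measure X) [IsProbabilityMeasure γ] (g h : X → E) (hg : Measurable g) (hh : Measurable h)
    (A : Set X) (δ : ℝ) (hA : ∀ x, x ∉ A → g x = h x)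
    (hδ : γ.real A ≤ δ) : tvDist (γ.map g) (γ.map h) ≤ δ := by
  unfold tvDist
  have : Nonempty {s : Set E // MeasurableSet s} := ⟨⟨∅, MeasurableSet.empty⟩⟩
  refine ciSup_le fun s => ?_
  rw [Measure.map_apply hg s.2, Measure.map_apply hh s.2]
  refine le_trans (abs_measureReal_sub_le_measureReal_symmDiff (μ := γ) (hg s.2).nullMeasurableSet
    (hh s.2).nullMeasurableSet) ?_
  refine le_trans (measureReal_mono ?_) hδ
  intro x hx
  by_contra hxA
  have := hA x hxA
  simp [Set.mem_symmDiff, this] at hx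

open ProbabilityTheory in
lemma gauss_tail (k : ℕ) (R : ℝ) (hR : 0 < R) :
    (Measure.pi fun _ : Fin k => gaussianReal 0 1).real {x | ∃ i, R < |x i|} ≤ k / R ^ 2 := by
  have h1 : (gaussianReal 0 1).real {y : ℝ | R < |y|} ≤ 1 / R ^ 2 := by
    have := meas_ge_le_variance_div_sq (μ := gaussianReal 0 1) (X := id)
      (memLp_id_gaussianReal 2) hR
    rw [variance_id_gaussianReal] at this
    simp only [id_eq, integral_id_gaussianReal, sub_zero, NNReal.coe_one] at this
    refine ENNReal.toReal_le_of_le_ofReal (by positivity) (le_trans (measure_mono ?_) this)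
    intro y hy
    exact (show R < |y| from hy).le
  have h2 : {x : Fin k → ℝ | ∃ i, R < |x i|} = ⋃ i, (Function.eval i) ⁻¹' {y : ℝ | R < |y|} := by
    ext x; simp
  rw [h2]
  refine le_trans (measureReal_iUnion_fintype_le _) ?_
  have h3 : ∀ i : Fin k, (Measure.pi fun _ : Fin k => gaussianReal 0 1).real
      ((Function.eval i) ⁻¹' {y : ℝ | R < |y|}) ≤ 1 / R ^ 2 := by
    intro i
    have hm : MeasurableSet {y : ℝ | R < |y|} := measurableSet_lt measurable_const (by fun_prop)
    have hmp := measurePreserving_eval (fun _ : Fin k => gaussianReal 0 1) i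
    rw [measureReal_def, hmp.measure_preimage hm.nullMeasurableSet]
    exact h1
  refine le_trans (Finset.sum_le_sum fun i _ => h3 i) ?_
  simp [div_eq_mul_inv]

lemma mulVec_bound {a b : ℕ} (M : Matrix (Fin a) (Fin b) ℝ) (v : Fin b → ℝ) (c r : ℝ) (d : ℕ)
    (hb : b ≤ d) (hr : 0 ≤ r) (hc : 0 ≤ c) (hM : ∀ i j, |M i j| ≤ c) (hv : ∀ j, |v j| ≤ r)
    (i : Fin a) : |M.mulVec v i| ≤ d * c * r := by
  unfold Matrix.mulVec dotProduct
  refine le_trans (Finset.abs_sum_le_sum_abs _ _) ?_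
  calc ∑ j, |M i j * v j| ≤ ∑ j : Fin b, c * r := by
        refine Finset.sum_le_sum fun j _ => ?_
        rw [abs_mul]
        exact mul_le_mul (hM i j) (hv j) (abs_nonneg _) hc
    _ = b * (c * r) := by simp
    _ ≤ d * (c * r) := by
        have : (b : ℝ) ≤ d := by exact_mod_cast hb
        gcongr
    _ = _ := by ring

lemma net_cont (σ : ℝ → ℝ) (hσ : LipschitzWith 1 σ) (dims : ℕ → ℕ)
    (W : (i : ℕ) → Matrix (Fin (dims (i + 1))) (Fin (dims i)) ℝ) (n : ℕ) :
    Continuous (net σ dims W n) := by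
  induction n with
  | zero => exact continuous_id
  | succ n ih =>
    refine continuous_pi fun j => hσ.continuous.comp ?_
    exact (continuous_apply j).comp (Continuous.matrix_mulVec continuous_const ih)

lemma net_bound (σ : ℝ → ℝ) (hσ : LipschitzWith 1 σ) (hσ0 : σ 0 = 0) (dims : ℕ → ℕ)
    (W : (i : ℕ) → Matrix (Fin (dims (i + 1))) (Fin (dims i)) ℝ) (B R : ℝ) (d ℓ : ℕ)
    (hB : 1 ≤ B) (hR : 0 ≤ R) (hd : ∀ i ≤ ℓ, dims i ≤ d)
    (hW : ∀ i < ℓ, ∀ j k, |W i j k| ≤ B) (x : Fin (dims 0) → ℝ) (hx : ∀ i, |x i| ≤ R)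
    (n : ℕ) (hn : n ≤ ℓ) (j : Fin (dims n)) : |net σ dims W n x j| ≤ (d * B) ^ n * R := by
  induction n with
  | zero => simpa [net] using hx j
  | succ n ih =>
    have h1 : |net σ dims W (n + 1) x j| ≤ |(W n).mulVec (net σ dims W n x) j| := by
      have := hσ.dist_le_mul ((W n).mulVec (net σ dims W n x) j) 0
      simpa [Real.dist_eq, hσ0, net] using this
    refine h1.trans ?_
    refine (mulVec_bound (W n) _ B ((d * B) ^ n * R) d (hd n (by omega)) (by positivity)
      (by positivity) (hW n (by omega)) (ih (by omega)) j).trans (le_of_eq (by ring))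

lemma net_diff (σ : ℝ → ℝ) (hσ : LipschitzWith 1 σ) (hσ0 : σ 0 = 0) (dims : ℕ → ℕ)
    (W W' : (i : ℕ) → Matrix (Fin (dims (i + 1))) (Fin (dims i)) ℝ) (B R η : ℝ) (d ℓ : ℕ)
    (hB : 1 ≤ B) (hR : 0 ≤ R) (hη : 0 ≤ η) (hd : ∀ i ≤ ℓ, dims i ≤ d)
    (hW : ∀ i < ℓ, ∀ j k, |W i j k| ≤ B) (hW' : ∀ i < ℓ, ∀ j k, |W' i j k| ≤ B)
    (hWW : ∀ i < ℓ, ∀ j k, |W i j k - W' i j k| ≤ η)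
    (x : Fin (dims 0) → ℝ) (hx : ∀ i, |x i| ≤ R)
    (n : ℕ) (hn : n ≤ ℓ) (j : Fin (dims n)) :
    |net σ dims W n x j - net σ dims W' n x j| ≤ n * (d * B) ^ n * η * R := by
  induction n with
  | zero => simp [net]
  | succ n ih =>
    have h1 := hσ.dist_le_mul ((W n).mulVec (net σ dims W n x) j)
      ((W' n).mulVec (net σ dims W' n x) j)
    rw [Real.dist_eq, Real.dist_eq, NNReal.coe_one, one_mul] at h1
    refine le_trans h1 ?_
    have h2 : (W n).mulVec (net σ dims W n x) j - (W' n).mulVec (net σ dims W' n x) j =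
        (W n).mulVec (net σ dims W n x - net σ dims W' n x) j +
          (W n - W' n).mulVec (net σ dims W' n x) j := by
      rw [Matrix.mulVec_sub, Matrix.sub_mulVec]; simp
    rw [h2]
    refine le_trans (abs_add_le _ _) ?_
    have h3 := mulVec_bound (W n) (net σ dims W n x - net σ dims W' n x) B
      (n * (d * B) ^ n * η * R) d (hd n (by omega)) (by positivity)
      (by positivity) (hW n (by omega)) (ih (by omega)) j
    have h4 := mulVec_bound (W n - W' n) (net σ dims W' n x) η
      ((d * B) ^ n * R) d (hd n (by omega)) (by positivity)
      (by positivity) (hWW n (by omega))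
      (net_bound σ hσ hσ0 dims W' B R d ℓ hB hR hd hW' x hx n (by omega)) j
    refine le_trans (add_le_add h3 h4) ?_
    have h5 : d * η * ((d * B) ^ n * R) ≤ B * (d * η * ((d * B) ^ n * R)) :=
      le_mul_of_one_le_left (by positivity) hB
    refine le_trans (add_le_add_right h5 _) (le_of_eq ?_)
    push_cast
    ring

lemma grid_aux (B w : ℝ) (N : ℕ) (hN : 0 < N) (hB : 1 ≤ B) (hw : |w| ≤ B) :
    ∃ t : Fin (N + 1), |w - (-B + 2 * B * (t : ℕ) / N)| ≤ 2 * B / N := by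
  have hN' : (0 : ℝ) < N := by exact_mod_cast hN
  obtain ⟨h1, h2⟩ := abs_le.1 hw
  have h0 : 0 ≤ (w + B) / (2 * B) * N := by
    have : 0 ≤ w + B := by linarith
    positivity
  have hle : (w + B) / (2 * B) * N ≤ N := by
    have : (w + B) / (2 * B) ≤ 1 := by rw [div_le_one (by positivity)]; linarith
    nlinarith
  have hf1 := Nat.floor_le h0
  have hf2 := Nat.lt_floor_add_one ((w + B) / (2 * B) * N)
  refine ⟨⟨⌊(w + B) / (2 * B) * N⌋₊, ?_⟩, ?_⟩
  · have : (⌊(w + B) / (2 * B) * N⌋₊ : ℝ) ≤ N := hf1.trans hle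
    have : ⌊(w + B) / (2 * B) * N⌋₊ ≤ N := by exact_mod_cast this
    omega
  · set t := (⌊(w + B) / (2 * B) * N⌋₊ : ℝ)
    have he : w - (-B + 2 * B * t / N) = 2 * B / N * ((w + B) / (2 * B) * N - t) := by
      field_simp
      ring
    change |w - (-B + 2 * B * t / N)| ≤ _
    rw [he, abs_mul, abs_of_nonneg (by positivity : 0 ≤ 2 * B / N)]
    refine mul_le_of_le_one_right (by positivity) ?_
    rw [abs_le]; constructor <;> linarith

lemma grid_bound (B : ℝ) (N : ℕ) (hN : 0 < N) (hB : 1 ≤ B) (t : Fin (N + 1)) :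
    |(-B + 2 * B * (t : ℕ) / N)| ≤ B := by
  have hN' : (0 : ℝ) < N := by exact_mod_cast hN
  have ht : ((t : ℕ) : ℝ) ≤ N := by exact_mod_cast Nat.lt_succ_iff.1 t.2
  have h1 : ((t : ℕ) : ℝ) / N ≤ 1 := by rwa [div_le_one hN']
  have h0 : 0 ≤ ((t : ℕ) : ℝ) / N := by positivity
  rw [mul_div_assoc, abs_le]
  constructor <;> nlinarith

/-- index type of weights -/
abbrev WIdx (dims : ℕ → ℕ) (ℓ : ℕ) : Type :=
  (i : Fin ℓ) × (Fin (dims (i + 1)) × Fin (dims i))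

def gridW (dims : ℕ → ℕ) (ℓ N : ℕ) (B : ℝ) (f : WIdx dims ℓ → Fin (N + 1)) (i : ℕ) :
    Matrix (Fin (dims (i + 1))) (Fin (dims i)) ℝ :=
  fun j k => if h : i < ℓ then -B + 2 * B * ((f ⟨⟨i, h⟩, (j, k)⟩ : Fin (N + 1)) : ℕ) / N else 0

lemma card_WIdx (dims : ℕ → ℕ) (ℓ : ℕ) :
    Fintype.card (WIdx dims ℓ) = ∑ i ∈ Finset.range ℓ, dims (i + 1) * dims i := by
  rw [Fintype.card_sigma, Finset.sum_range]
  simp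

lemma euclid_bound {a : ℕ} (d : ℕ) (ha : a ≤ d) (v : EuclideanSpace ℝ (Fin a)) (r : ℝ) (hr : 0 ≤ r)
    (hv : ∀ i, |v i| ≤ r) : ‖v‖ ≤ d * r := by
  rw [EuclideanSpace.norm_eq]
  refine Real.sqrt_le_iff.2 ⟨by positivity, ?_⟩
  calc ∑ i, ‖v i‖ ^ 2 ≤ ∑ i : Fin a, r ^ 2 := by
        refine Finset.sum_le_sum fun i _ => ?_
        exact pow_le_pow_left₀ (norm_nonneg _) (hv i) 2
    _ = a * r ^ 2 := by simp
    _ ≤ (d : ℝ) ^ 2 * r ^ 2 := by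
        have h1 : (a : ℝ) ≤ d := by exact_mod_cast ha
        have h2 : (d : ℝ) ≤ (d : ℝ) ^ 2 := by exact_mod_cast Nat.le_self_pow (by norm_num) d
        gcongr
        linarith
    _ = _ := by ring

lemma arith_aux (δ B : ℝ) (d ℓ N : ℕ) (hδ : 0 < δ) (hδ1 : δ < 1) (hB : 1 ≤ B) (hd : 2 ≤ d)
    (hN : ((d : ℝ) * B / δ) ^ (2 * ℓ + 4) ≤ N) :
    d * (ℓ * (d * B) ^ ℓ * (2 * B / N) * (d / δ)) ≤ δ / 2 := by
  have hd' : (2 : ℝ) ≤ d := by exact_mod_cast hd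
  set L := (d : ℝ) * B / δ with hL
  have hdB : (d : ℝ) * B ≤ L := by
    rw [hL, le_div_iff₀ hδ]; nlinarith [mul_nonneg (by linarith : (0:ℝ) ≤ d) (by linarith : 0 ≤ B)]
  have hL2 : 2 ≤ L := by nlinarith
  have hNpos : (0 : ℝ) < N := lt_of_lt_of_le (by positivity) hN
  have hℓ : (ℓ : ℝ) ≤ L ^ ℓ := by
    have h1 : (ℓ : ℝ) ≤ 2 ^ ℓ := by exact_mod_cast Nat.lt_two_pow_self.le
    exact h1.trans (pow_le_pow_left₀ (by norm_num) hL2 ℓ)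
  have h2 : ((d : ℝ) * B) ^ ℓ ≤ L ^ ℓ := pow_le_pow_left₀ (by positivity) hdB ℓ
  have h3 : (d : ℝ) ^ 2 * B / δ ^ 2 ≤ L ^ 2 := by
    rw [hL, div_pow, mul_pow]
    have : B ≤ B ^ 2 := by nlinarith
    gcongr
  have h4 : (4 : ℝ) ≤ L ^ 2 := by nlinarith
  have h5 : 4 * (ℓ * (d * B) ^ ℓ * ((d : ℝ) ^ 2 * B / δ ^ 2)) ≤ N := by
    refine le_trans ?_ hN
    calc 4 * (ℓ * (d * B) ^ ℓ * ((d : ℝ) ^ 2 * B / δ ^ 2)) ≤ L ^ 2 * (L ^ ℓ * L ^ ℓ * L ^ 2) := by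
          gcongr
      _ = _ := by ring
  have h6 : d * (ℓ * (d * B) ^ ℓ * (2 * B / N) * (d / δ)) =
      (δ / 2) * (4 * (ℓ * (d * B) ^ ℓ * ((d : ℝ) ^ 2 * B / δ ^ 2)) / N) := by
    field_simp
    ring
  rw [h6]
  refine mul_le_of_le_one_right (by positivity) ?_
  rwa [div_le_one hNpos]

lemma one_aux (δ B : ℝ) (hδ : 0 < δ) (hδ1 : δ < 1) (hB : 1 ≤ B)
    (d ℓ N : ℕ) (hd : 2 ≤ d)
    (σ : ℝ → ℝ) (hσ : LipschitzWith 1 σ) (hσ0 : σ 0 = 0)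
    (dims : ℕ → ℕ) (hdims : ∀ i ≤ ℓ, dims i ≤ d) (ε : ℝ) (hε : 0 ≤ ε)
    (hN0 : 0 < N) (hN : ((d : ℝ) * B / δ) ^ (2 * ℓ + 4) ≤ N)
    (D : Measure (EuclideanSpace ℝ (Fin (dims ℓ)))) [IsProbabilityMeasure D]
    (W : (i' : ℕ) → Matrix (Fin (dims (i' + 1))) (Fin (dims i')) ℝ)
    (hW : ∀ i' : ℕ, i' < ℓ → ∀ j k', |W i' j k'| ≤ B)
    (hWD : Winfty D (netDist σ dims W ℓ) ≤ ENNReal.ofReal ε) :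
    ∃ f : WIdx dims ℓ → Fin (N + 1),
      ∃ E'' : Measure (EuclideanSpace ℝ (Fin (dims ℓ))), IsProbabilityMeasure E'' ∧
          tvDist (netDist σ dims (gridW dims ℓ N B f) ℓ) E'' ≤ δ ∧
          Winfty E'' D ≤ ENNReal.ofReal (ε + δ) := by
  have hd' : (2 : ℝ) ≤ d := by exact_mod_cast hd
  choose f hf using fun p : WIdx dims ℓ => grid_aux B (W p.1 p.2.1 p.2.2) N hN0 hB
    (hW p.1 p.1.2 p.2.1 p.2.2)
  refine ⟨f, ?_⟩
  set W' := gridW dims ℓ N B f with hW'def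
  have hW' : ∀ i < ℓ, ∀ j k, |W' i j k| ≤ B := by
    intro i hi j k
    simp only [hW'def, gridW, hi, dif_pos]
    exact grid_bound B N hN0 hB _
  have hWW : ∀ i < ℓ, ∀ j k, |W i j k - W' i j k| ≤ 2 * B / N := by
    intro i hi j k
    simp only [hW'def, gridW, hi, dif_pos]
    exact hf ⟨⟨i, hi⟩, (j, k)⟩
  have hR : 0 < (d : ℝ) / δ := by positivity
  set R := (d : ℝ) / δ with hRdef
  set γ := (Measure.pi fun _ : Fin (dims 0) => ProbabilityTheory.gaussianReal 0 1) with hγ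
  set A : Set (Fin (dims 0) → ℝ) := {x | ∃ i, R < |x i|} with hA
  have hAm : MeasurableSet A := by
    have : A = ⋃ i, {x : Fin (dims 0) → ℝ | R < |x i|} := by ext x; simp [hA]
    rw [this]
    exact MeasurableSet.iUnion fun i => measurableSet_lt measurable_const (by fun_prop)
  set g : (Fin (dims 0) → ℝ) → EuclideanSpace ℝ (Fin (dims ℓ)) := fun x =>
    (EuclideanSpace.equiv (Fin (dims ℓ)) ℝ).symm (net σ dims W ℓ x) with hgdef
  set g' : (Fin (dims 0) → ℝ) → EuclideanSpace ℝ (Fin (dims ℓ)) := fun x =>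
    (EuclideanSpace.equiv (Fin (dims ℓ)) ℝ).symm (net σ dims W' ℓ x) with hg'def
  have hg : Measurable g := ((EuclideanSpace.equiv (Fin (dims ℓ)) ℝ).symm.continuous.comp
    (net_cont σ hσ dims W ℓ)).measurable
  have hg' : Measurable g' := ((EuclideanSpace.equiv (Fin (dims ℓ)) ℝ).symm.continuous.comp
    (net_cont σ hσ dims W' ℓ)).measurable
  classical
  have hh : Measurable (A.piecewise g g') := hg.piecewise hAm hg'
  refine ⟨γ.map (A.piecewise g g'), Measure.isProbabilityMeasure_map hh.aemeasurable, ?_, ?_⟩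
  · refine tv_aux γ g' _ hg' hh A δ (fun x hx => by simp [hx]) ?_
    refine (gauss_tail (dims 0) R hR).trans ?_
    have h0 : (dims 0 : ℝ) ≤ d := by exact_mod_cast hdims 0 (by omega)
    rw [div_le_iff₀ (by positivity), hRdef]
    have : δ * ((d : ℝ) / δ) ^ 2 = d * (d / δ) := by field_simp
    rw [this]
    have : 1 ≤ (d : ℝ) / δ := by rw [le_div_iff₀ hδ]; linarith
    nlinarith
  · refine glue_aux γ g _ hg hh D ε δ hε hδ hWD fun x => ?_
    by_cases hx : x ∈ A
    · simp [hx]; positivity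
    · have hx' : ∀ i, |x i| ≤ R := by simpa [hA] using hx
      rw [Set.piecewise_eq_of_notMem _ _ _ hx, norm_sub_rev]
      refine (euclid_bound d (hdims ℓ le_rfl) (g x - g' x) _ ?_ fun j =>
        net_diff σ hσ hσ0 dims W W' B R (2 * B / N) d ℓ hB hR.le (by positivity) hdims hW hW'
          hWW x hx' ℓ le_rfl j).trans (arith_aux δ B d ℓ N hδ hδ1 hB hd hN)
      positivity

lemma count_aux (L : ℝ) (hL : 2 ≤ L) (ℓ m : ℕ) (hℓ : 1 ≤ ℓ) :
    Real.log (((⌈L ^ (2 * ℓ + 4)⌉₊ + 1) ^ m * (⌈L ^ (2 * ℓ + 4)⌉₊ + 1) ^ m : ℕ) : ℝ) ≤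
      14 * m * ℓ * Real.log L := by
  have h1 : ((⌈L ^ (2 * ℓ + 4)⌉₊ + 1 : ℕ) : ℝ) ≤ L ^ (7 * ℓ) := by
    push_cast
    have h2 := (Nat.ceil_lt_add_one (by positivity : 0 ≤ L ^ (2 * ℓ + 4))).le
    have h3 : 2 ≤ L ^ (2 * ℓ + 4) := hL.trans (le_self_pow₀ (by linarith) (by omega))
    have h4 : L ^ (2 * ℓ + 5) ≤ L ^ (7 * ℓ) := pow_le_pow_right₀ (by linarith) (by omega)
    have h5 : L ^ (2 * ℓ + 5) = L ^ (2 * ℓ + 4) * L := pow_succ _ _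
    nlinarith
  rw [← pow_add]
  push_cast at h1 ⊢
  rw [Real.log_pow]
  have h6 := Real.log_le_log (by positivity) h1
  rw [Real.log_pow] at h6
  refine (mul_le_mul_of_nonneg_left h6 (by positivity)).trans (le_of_eq ?_)
  push_cast
  ring

/-- Families of distribution pairs that are `W∞`-approximated by `ℓ`-layer
generative networks with widths `≤ d` and weights in `[−B,B]` admit a `(W∞, TV)`-cover `𝒩`
with `log |𝒩| ≤ C·m·ℓ·log(dB/δ)`, where `m` is the number of weights. -/
theorem stmt19 :
    ∃ C : ℝ, 0 < C ∧
    ∀ δ B : ℝ, 0 < δ → δ < 1 → 1 ≤ B →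
    ∀ d ℓ k : ℕ, 2 ≤ d → 1 ≤ ℓ → k ≤ d →
    ∀ σ : ℝ → ℝ, LipschitzWith 1 σ → σ 0 = 0 →
    ∀ dims : ℕ → ℕ, dims 0 = k → (∀ i : ℕ, i ≤ ℓ → dims i ≤ d) →
    ∀ ε : ℝ, 0 ≤ ε →
    ∀ 𝒟 : Set (Measure (EuclideanSpace ℝ (Fin (dims ℓ))) ×
        Measure (EuclideanSpace ℝ (Fin (dims ℓ)))),
    (∀ D ∈ 𝒟, IsProbabilityMeasure D.1 ∧ IsProbabilityMeasure D.2) →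
    (∀ D ∈ 𝒟, ∀ i : Bool,
      ∃ W : (i' : ℕ) → Matrix (Fin (dims (i' + 1))) (Fin (dims i')) ℝ,
        (∀ i' : ℕ, i' < ℓ → ∀ j k', |W i' j k'| ≤ B) ∧
        Winfty (cond i D.2 D.1) (netDist σ dims W ℓ) ≤ ENNReal.ofReal ε) →
    ∃ 𝒩 : Finset (Measure (EuclideanSpace ℝ (Fin (dims ℓ))) ×
        Measure (EuclideanSpace ℝ (Fin (dims ℓ)))),
      (∀ N ∈ 𝒩, IsProbabilityMeasure N.1 ∧ IsProbabilityMeasure N.2) ∧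
      Real.log 𝒩.card ≤
        C * ((∑ i ∈ Finset.range ℓ, dims (i + 1) * dims i : ℕ) : ℝ) * ℓ *
          Real.log ((d : ℝ) * B / δ) ∧
      ∀ D ∈ 𝒟, ∃ N ∈ 𝒩, ∀ i : Bool,
        ∃ E'' : Measure (EuclideanSpace ℝ (Fin (dims ℓ))), IsProbabilityMeasure E'' ∧
          tvDist (cond i N.2 N.1) E'' ≤ δ ∧
          Winfty E'' (cond i D.2 D.1) ≤ ENNReal.ofReal (ε + δ) := by
  refine ⟨14, by norm_num, ?_⟩
  intro δ B hδ hδ1 hB d ℓ k hd hℓ hk σ hσ hσ0 dims hk0 hdims ε hε 𝒟 hP hD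
  classical
  have hd' : (2 : ℝ) ≤ d := by exact_mod_cast hd
  set L := (d : ℝ) * B / δ with hL
  have hL2 : 2 ≤ L := by
    rw [hL, le_div_iff₀ hδ]
    nlinarith
  set N := ⌈L ^ (2 * ℓ + 4)⌉₊ with hNdef
  have hN : L ^ (2 * ℓ + 4) ≤ N := Nat.le_ceil _
  have hN0 : 0 < N := Nat.ceil_pos.2 (by positivity)
  let F : (WIdx dims ℓ → Fin (N + 1)) → Measure (EuclideanSpace ℝ (Fin (dims ℓ))) :=
    fun f => netDist σ dims (gridW dims ℓ N B f) ℓ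
  have hF : ∀ f, IsProbabilityMeasure (F f) := fun f =>
    Measure.isProbabilityMeasure_map
      ((EuclideanSpace.equiv (Fin (dims ℓ)) ℝ).symm.continuous.comp
        (net_cont σ hσ dims _ ℓ)).measurable.aemeasurable
  refine ⟨Finset.univ.image fun p : (WIdx dims ℓ → Fin (N + 1)) × (WIdx dims ℓ → Fin (N + 1)) =>
    (F p.1, F p.2), ?_, ?_, ?_⟩
  · intro M hM
    obtain ⟨p, -, rfl⟩ := Finset.mem_image.1 hM
    exact ⟨hF _, hF _⟩
  · refine le_trans (Real.log_le_log ?_ ?_) (count_aux L hL2 ℓ _ hℓ)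
    · have : (Finset.univ.image fun p : (WIdx dims ℓ → Fin (N + 1)) × (WIdx dims ℓ → Fin (N + 1)) =>
        (F p.1, F p.2)).Nonempty := Finset.univ_nonempty.image _
      exact_mod_cast this.card_pos
    · refine Nat.cast_le.2 (Finset.card_image_le.trans (le_of_eq ?_))
      rw [Finset.card_univ, Fintype.card_prod, Fintype.card_fun, card_WIdx, Fintype.card_fin]
  · intro D hDm
    have key : ∀ i : Bool, ∃ f : WIdx dims ℓ → Fin (N + 1),
        ∃ E'' : Measure (EuclideanSpace ℝ (Fin (dims ℓ))), IsProbabilityMeasure E'' ∧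
          tvDist (netDist σ dims (gridW dims ℓ N B f) ℓ) E'' ≤ δ ∧
          Winfty E'' (cond i D.2 D.1) ≤ ENNReal.ofReal (ε + δ) := by
      intro i
      obtain ⟨W, hW, hWD⟩ := hD D hDm i
      have : IsProbabilityMeasure (cond i D.2 D.1) := by
        cases i
        · exact (hP D hDm).1
        · exact (hP D hDm).2
      exact one_aux δ B hδ hδ1 hB d ℓ N hd σ hσ hσ0 dims hdims ε hε hN0 hN _ W hW hWD
    obtain ⟨f0, h0⟩ := key false
    obtain ⟨f1, h1⟩ := key true
    refine ⟨(F f0, F f1), Finset.mem_image.2 ⟨(f0, f1), Finset.mem_univ _, rfl⟩, fun i => ?_⟩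
    cases i
    · exact h0
    · exact h1

end
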